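/- Let K be an imaginary quadratic field, O an order in K of conductor ℓ_O, and N a positive integer. The assignment [𝔞𝔟⁻¹] ↦ [(𝔞O_K)(𝔟O_K)⁻¹], where 𝔞 and 𝔟 run over nonzero (proper) O-ideals prime to ℓ_O N, is a well-defined group isomorphism from C_N(O, ℓ_O N) = I(O, ℓ_O N)/P_N(O, ℓ_O N) onto I(O_K, ℓ_O N)/P_{ℤ,N}(O_K, ℓ_O N). -/

import Mathlib

open scoped nonZeroDivisors

set_option synthInstance.maxHeartbeats 1000000
set_option maxHeartbeats 1000000

noncomputable section

variable (K : Type) [Field K] [NumberField K]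

/-- The fractional `O`-ideals of `K` (for `O` a subring of `K`). -/
abbrev Frac (O : Subalgebra ℤ K) := FractionalIdeal ((O : Type))⁰ K

/-- A nonzero ideal `a` of `O` is *prime to* `m` if `a + mO = O`. -/
def primeTo (O : Subalgebra ℤ K) (m : ℕ) (a : Ideal O) : Prop :=
  a ⊔ Ideal.span {(m : O)} = ⊤

/-- `M(O, m)`: the nonzero proper (equivalently, invertible) `O`-ideals prime to `m`. -/
def Mset (O : Subalgebra ℤ K) (m : ℕ) : Set (Ideal O) :=
  {a | a ≠ 0 ∧ primeTo K O m a ∧ IsUnit (a : Frac K O)}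

/-- `I(O, m)`: the subgroup of the group of invertible fractional `O`-ideals generated by
`M(O, m)`. -/
def Igrp (O : Subalgebra ℤ K) (m : ℕ) : Subgroup (Frac K O)ˣ :=
  Subgroup.closure {u | ∃ a ∈ Mset K O m, (u : Frac K O) = a}

/-- `O` is an order of the imaginary quadratic field `K`:  `K` has degree 2 over `ℚ`, has no
real embeddings, and `O` is a subring of `K` which is finitely generated as a ℤ-module and
contains a ℚ-basis of `K` (i.e. spans `K` over ℚ). -/
structure IsImagQuadOrder (O : Subalgebra ℤ K) : Prop where
  degree_two : Module.finrank ℚ K = 2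
  no_real_embedding : ∀ v : NumberField.InfinitePlace K, v.IsComplex
  fg : (Subalgebra.toSubmodule O).FG
  spans : Submodule.span ℚ (O : Set K) = ⊤

/-- `P_N(O, m)`: the subgroup generated by the principal ideals `νO` with `ν ∈ O` nonzero,
`νO` prime to `m`, and `ν ≡ 1 (mod NO)`. -/
def PgrpM (O : Subalgebra ℤ K) (N m : ℕ) : Subgroup (Frac K O)ˣ :=
  Subgroup.closure {u | ∃ ν : (O : Type), ν ≠ 0 ∧ primeTo K O m (Ideal.span {ν}) ∧
    (∃ μ : (O : Type), ν = 1 + (N : (O : Type)) * μ) ∧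
    (u : Frac K O) = ((Ideal.span {ν} : Ideal O) : Frac K O)}

/-- `P_N(O)`: the subgroup generated by the principal ideals `νO` with `ν ∈ O` nonzero and
`ν ≡ 1 (mod NO)`. -/
def Pgrp (O : Subalgebra ℤ K) (N : ℕ) : Subgroup (Frac K O)ˣ :=
  Subgroup.closure {u | ∃ ν : (O : Type), ν ≠ 0 ∧ (∃ μ : (O : Type), ν = 1 + (N : (O : Type)) * μ) ∧
    (u : Frac K O) = ((Ideal.span {ν} : Ideal O) : Frac K O)}

/-- The ray class group `C_N(O) = I(O, N)/P_N(O)` of the order `O` modulo `NO`. -/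
abbrev ClsGrp (O : Subalgebra ℤ K) (N : ℕ) :=
  (Igrp K O N) ⧸ ((Pgrp K O N).subgroupOf (Igrp K O N))

/-- `C_N(O, m) = I(O, m)/P_N(O, m)`. -/
abbrev ClsGrpM (O : Subalgebra ℤ K) (N m : ℕ) :=
  (Igrp K O m) ⧸ ((PgrpM K O N m).subgroupOf (Igrp K O m))

/-- The condOrder `ℓ_O = [O_K : O]`, as the index of `O` in the maximal order (the integral
closure of `ℤ` in `K`) as additive subgroups of `K`. -/
def condOrder (O : Subalgebra ℤ K) : ℕ :=
  AddSubgroup.relIndex (Subalgebra.toSubmodule O).toAddSubgroup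
    (Subalgebra.toSubmodule (integralClosure ℤ K)).toAddSubgroup

/-- `P_{ℤ,N}(O_K, m)`: the subgroup of invertible fractional ideals of the maximal order
`O_K = integralClosure ℤ K` generated by the principal ideals `νO_K` with `ν ∈ O_K` nonzero,
`νO_K` prime to `m`, and `ν ≡ a (mod m O_K)` for some integer `a` with `a ≡ 1 (mod N)`. -/
def PZgrp (N m : ℕ) : Subgroup (Frac K (integralClosure ℤ K))ˣ :=
  Subgroup.closure {u | ∃ ν : ((integralClosure ℤ K : Subalgebra ℤ K) : Type), ν ≠ 0 ∧
    primeTo K (integralClosure ℤ K) m (Ideal.span {ν}) ∧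
    (∃ a b : ℤ, a = 1 + (N : ℤ) * b ∧
      ∃ μ : ((integralClosure ℤ K : Subalgebra ℤ K) : Type),
        ν = (a : ((integralClosure ℤ K : Subalgebra ℤ K) : Type))
            + (m : ((integralClosure ℤ K : Subalgebra ℤ K) : Type)) * μ) ∧
    (u : Frac K (integralClosure ℤ K)) =
      ((Ideal.span {ν} : Ideal (integralClosure ℤ K)) : Frac K (integralClosure ℤ K))}

/-- The generalized ideal class group `I(O_K, m)/P_{ℤ,N}(O_K, m)`. -/
abbrev GenClsGrp (N m : ℕ) :=
  (Igrp K (integralClosure ℤ K) m) ⧸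
    ((PZgrp K N m).subgroupOf (Igrp K (integralClosure ℤ K) m))

/-- The extension `𝔞 ↦ 𝔞O_K` of an ideal of `O` to the maximal order: the ideal of
`O_K = integralClosure ℤ K` generated by (the image in `O_K` of) `𝔞`. -/
def extIdeal (O : Subalgebra ℤ K) (a : Ideal O) : Ideal (integralClosure ℤ K) :=
  Ideal.span {x : ((integralClosure ℤ K : Subalgebra ℤ K) : Type) |
    (x : K) ∈ Subtype.val '' (a : Set (O : Type))}

section ConductorIdeals

variable {A B : Type*} [CommRing A] [CommRing B] {f : A →+* B} {m : ℕ}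

theorem sup_span_natCast_map_eq_top_iff (hf : Function.Injective f) (hi : f.IsIntegral)
    (a : Ideal A) :
    a.map f ⊔ Ideal.span {(m : B)} = ⊤ ↔ a ⊔ Ideal.span {(m : A)} = ⊤ := by
  rw [← Ideal.map_eq_top_iff f hf hi (I := a ⊔ Ideal.span {(m : A)}), Ideal.map_sup,
    Ideal.map_span, Set.image_singleton, map_natCast]

theorem exists_mem_natCast_mul_eq_one {R : Type*} [CommRing R] {m : ℕ} {a : Ideal R}
    (ha : a ⊔ Ideal.span {(m : R)} = ⊤) : ∃ y ∈ a, ∃ z : R, y + m * z = 1 := by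
  obtain ⟨y, hy, w, hw, h⟩ := Submodule.mem_sup.1 ((Ideal.eq_top_iff_one _).1 ha)
  obtain ⟨z, rfl⟩ := Ideal.mem_span_singleton.1 hw
  exact ⟨y, hy, z, h⟩

theorem sup_span_natCast_eq_top_of_mem {R : Type*} [CommRing R] {m : ℕ} {a : Ideal R} {x z : R}
    (hx : x ∈ a) (h : x + m * z = 1) : a ⊔ Ideal.span {(m : R)} = ⊤ := by
  rw [Ideal.eq_top_iff_one, ← h]
  exact Submodule.add_mem_sup hx (Ideal.mul_mem_right _ _ (Ideal.mem_span_singleton_self _))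

theorem exists_mem_of_mem_map (hm : ∀ z : B, ∃ s, f s = m * z) {a : Ideal A} {t : B}
    (ht : t ∈ a.map f) : ∃ s ∈ a, f s = m * t := by
  suffices h : ∀ c : B, ∃ s ∈ a, f s = m * (c * t) by simpa using h 1
  induction ht using Submodule.span_induction with
  | mem x hx =>
    intro c
    obtain ⟨s, hs, rfl⟩ := hx
    obtain ⟨r, hr⟩ := hm c
    exact ⟨r * s, a.mul_mem_left _ hs, by rw [map_mul, hr]; ring⟩
  | zero => exact fun c ↦ ⟨0, a.zero_mem, by simp⟩
  | add x y _ _ hx hy =>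
    intro c
    obtain ⟨s, hs, h⟩ := hx c
    obtain ⟨s', hs', h'⟩ := hy c
    exact ⟨s + s', a.add_mem hs hs', by rw [map_add, h, h']; ring⟩
  | smul d x _ hx =>
    intro c
    obtain ⟨s, hs, h⟩ := hx (c * d)
    exact ⟨s, hs, by rw [h, smul_eq_mul]; ring⟩

theorem comap_map_eq_of_sup_span_natCast_eq_top (hf : Function.Injective f)
    (hm : ∀ z : B, ∃ s, f s = m * z) {a : Ideal A} (ha : a ⊔ Ideal.span {(m : A)} = ⊤) :
    (a.map f).comap f = a := by
  refine le_antisymm (fun x hx ↦ ?_) Ideal.le_comap_map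
  obtain ⟨y, hy, z, h⟩ := exists_mem_natCast_mul_eq_one ha
  obtain ⟨s, hs, hsx⟩ := exists_mem_of_mem_map hm (Ideal.mem_comap.1 hx)
  have hs' : s = m * x := hf (by rw [hsx, map_mul, map_natCast])
  have : x = x * y + z * s := by rw [hs']; linear_combination (-x) * h
  rw [this]
  exact a.add_mem (a.mul_mem_left _ hy) (a.mul_mem_left _ hs)

theorem map_comap_eq_of_sup_span_natCast_eq_top
    (hm : ∀ z : B, ∃ s, f s = m * z) {b : Ideal B} (hb : b ⊔ Ideal.span {(m : B)} = ⊤) :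
    (b.comap f).map f = b := by
  refine le_antisymm Ideal.map_comap_le (fun t ht ↦ ?_)
  obtain ⟨y, hy, z, h⟩ := exists_mem_natCast_mul_eq_one hb
  obtain ⟨s, hs⟩ := hm z
  obtain ⟨r, hr⟩ := hm t
  have hy' : f (1 - s) = y := by rw [map_sub, map_one, hs]; linear_combination -h
  have : t = t * f (1 - s) + z * f r := by rw [hy', hr]; linear_combination (-t) * h
  rw [this]
  refine add_mem (Ideal.mul_mem_left _ _ (Ideal.mem_map_of_mem f ?_))
    (Ideal.mul_mem_left _ _ (Ideal.mem_map_of_mem f ?_))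
  · rwa [Ideal.mem_comap, hy']
  · rw [Ideal.mem_comap, hr]
    exact b.mul_mem_left _ ht

theorem exists_ne_zero_mem_natCast_mul_eq_one {R : Type*} [CommRing R] [IsDomain R] {m : ℕ}
    {b : Ideal R} (hb0 : b ≠ ⊥) (hb : b ⊔ Ideal.span {(m : R)} = ⊤) :
    ∃ y ∈ b, y ≠ 0 ∧ ∃ z : R, y + m * z = 1 := by
  obtain ⟨y, hy, z, h⟩ := exists_mem_natCast_mul_eq_one hb
  by_cases hy0 : y = 0
  · obtain ⟨t, ht, ht0⟩ := Submodule.exists_mem_ne_zero_of_ne_bot hb0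
    refine ⟨m * t, b.mul_mem_left _ ht, mul_ne_zero ?_ ht0, z - t, ?_⟩
    · rintro hm
      simp [hy0, hm] at h
    · rw [← h, hy0]; ring
  · exact ⟨y, hy, hy0, z, h⟩

theorem exists_comap_mul_eq_span_singleton [IsDomain A] [IsDedekindDomain B]
    (hf : Function.Injective f) (hi : f.IsIntegral) (hm : ∀ z : B, ∃ s, f s = m * z)
    {b : Ideal B} (hb0 : b ≠ ⊥) (hb : b ⊔ Ideal.span {(m : B)} = ⊤) :
    ∃ (a : Ideal A) (x : A), x ≠ 0 ∧ b.comap f * a = Ideal.span {x} := by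
  obtain ⟨y, hy, hy0, z, h⟩ := exists_ne_zero_mem_natCast_mul_eq_one hb0 hb
  obtain ⟨s, hs⟩ := hm z
  have hx : f (1 - s) = y := by rw [map_sub, map_one, hs]; linear_combination -h
  obtain ⟨b', hb'⟩ := Ideal.dvd_iff_le.2 ((Ideal.span_singleton_le_iff_mem b).2 hy)
  have hyb' : y ∈ b' := by
    have : y ∈ b * b' := by
      rw [← hb']
      exact Ideal.mem_span_singleton_self y
    exact Ideal.mul_le_right this
  have hmap : (b.comap f * b'.comap f).map f = (Ideal.span {1 - s}).map f := by
    rw [Ideal.map_mul, map_comap_eq_of_sup_span_natCast_eq_top hm hb,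
      map_comap_eq_of_sup_span_natCast_eq_top hm (sup_span_natCast_eq_top_of_mem hyb' h),
      Ideal.map_span, Set.image_singleton, hx, hb']
  have hp : (Ideal.span {1 - s}).map f ⊔ Ideal.span {(m : B)} = ⊤ := by
    rw [Ideal.map_span, Set.image_singleton, hx]
    exact sup_span_natCast_eq_top_of_mem (Ideal.mem_span_singleton_self y) h
  refine ⟨b'.comap f, 1 - s, fun h0 ↦ hy0 (by rw [← hx, h0, map_zero]), ?_⟩
  have hp' : (b.comap f * b'.comap f).map f ⊔ Ideal.span {(m : B)} = ⊤ := by rw [hmap, hp]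
  calc
    _ = ((b.comap f * b'.comap f).map f).comap f :=
      (comap_map_eq_of_sup_span_natCast_eq_top hf hm
        ((sup_span_natCast_map_eq_top_iff hf hi _).1 hp')).symm
    _ = ((Ideal.span {1 - s}).map f).comap f := by rw [hmap]
    _ = _ := comap_map_eq_of_sup_span_natCast_eq_top hf hm
        ((sup_span_natCast_map_eq_top_iff hf hi _).1 hp)

end ConductorIdeals

section QuadraticOrders

open NumberField

theorem exists_addMonoidHom_ker_eq_intCast {K : Type} [Field K] [NumberField K]
    (h : Module.finrank ℚ K = 2) :
    ∃ φ : integralClosure ℤ K →+ ℤ, Function.Surjective φ ∧ ∀ x, φ x = 0 ↔ ∃ c : ℤ, x = c := by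
  let S : Submodule ℤ (𝓞 K) := Submodule.span ℤ {1}
  have hS (x : 𝓞 K) : x ∈ S ↔ ∃ c : ℤ, x = c := by
    simp [S, Submodule.mem_span_singleton, eq_comm]
  have htf : Module.IsTorsionFree ℤ (𝓞 K ⧸ S) := by
    refine .of_smul_eq_zero fun n q hq ↦ ?_
    obtain ⟨x, rfl⟩ := Submodule.Quotient.mk_surjective S q
    rw [← Submodule.Quotient.mk_smul, Submodule.Quotient.mk_eq_zero, hS] at hq
    obtain ⟨c, hc⟩ := hq
    by_cases hn : n = 0
    · exact .inl hn
    right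
    rw [Submodule.Quotient.mk_eq_zero, hS]
    have hxq : (x : K) = algebraMap ℚ K (c / n) := by
      have := congrArg (algebraMap (𝓞 K) K) hc
      have hnK : (n : K) ≠ 0 := by exact_mod_cast hn
      simp at this ⊢
      field_simp
      linear_combination this
    have hint : IsIntegral ℤ (c / n : ℚ) := by
      rw [← isIntegral_algebraMap_iff (algebraMap ℚ K).injective, ← hxq]
      exact x.2
    obtain ⟨d, hd⟩ := IsIntegrallyClosed.isIntegral_iff.1 hint
    refine ⟨d, ?_⟩
    apply RingOfIntegers.ext
    rw [hxq, ← hd]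
    simp
  have hfin : Module.Finite ℤ (𝓞 K ⧸ S) := inferInstance
  have hfree : Module.Free ℤ (𝓞 K ⧸ S) := inferInstance
  have hrank : Module.finrank ℤ (𝓞 K ⧸ S) = 1 := by
    have h1 := S.finrank_quotient_add_finrank
    have h2 : Module.finrank ℤ S = 1 := by
      rw [← (LinearEquiv.toSpanNonzeroSingleton ℤ (𝓞 K) 1 one_ne_zero).finrank_eq,
        Module.finrank_self]
    rw [RingOfIntegers.rank, h, h2] at h1
    omega
  let e : (𝓞 K ⧸ S) ≃ₗ[ℤ] ℤ :=
    LinearEquiv.ofFinrankEq _ _ (by rw [hrank, Module.finrank_self])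
  refine ⟨(e.toLinearMap ∘ₗ S.mkQ).toAddMonoidHom,
    e.surjective.comp S.mkQ_surjective, fun x ↦ ?_⟩
  change e (S.mkQ x) = 0 ↔ _
  rw [e.map_eq_zero_iff]
  exact (Submodule.Quotient.mk_eq_zero S (x := (x : 𝓞 K))).trans (hS x)

theorem IsImagQuadOrder.le_integralClosure {K : Type} [Field K] [NumberField K]
    {O : Subalgebra ℤ K} (hO : IsImagQuadOrder K O) : O ≤ integralClosure ℤ K :=
  fun x hx ↦ IsIntegral.of_mem_of_fg O hO.fg x hx

/-- An order of conductor `ℓ` in a quadratic field is `ℤ + ℓ O_K`. -/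
theorem IsImagQuadOrder.coe_mem_iff {K : Type} [Field K] [NumberField K]
    {O : Subalgebra ℤ K} (hO : IsImagQuadOrder K O) (x : integralClosure ℤ K) :
    (x : K) ∈ O ↔ ∃ (c : ℤ) (y : integralClosure ℤ K), x = c + (condOrder K O : ℕ) * y := by
  obtain ⟨φ, hφ, hker⟩ := exists_addMonoidHom_ker_eq_intCast hO.degree_two
  let H : AddSubgroup (integralClosure ℤ K) :=
    (Subalgebra.toSubmodule O).toAddSubgroup.addSubgroupOf
      (Subalgebra.toSubmodule (integralClosure ℤ K)).toAddSubgroup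
  have hH (x : integralClosure ℤ K) : x ∈ H ↔ (x : K) ∈ O := Iff.rfl
  have hker_le : φ.ker ≤ H := by
    intro x hx
    obtain ⟨c, rfl⟩ := (hker x).1 hx
    rw [hH]
    simp
  have hcomap : (H.map φ).comap φ = H := by
    rw [AddSubgroup.comap_map_eq, sup_eq_left.2 hker_le]
  obtain ⟨d, hd⟩ := Int.subgroup_cyclic (H.map φ)
  rw [← AddSubgroup.zmultiples_eq_closure] at hd
  have hindex : condOrder K O = d.natAbs := by
    change H.index = _
    rw [← hcomap, AddSubgroup.index_comap_of_surjective _ hφ, hd, Int.index_zmultiples]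
  rw [← hH, ← hcomap, AddSubgroup.mem_comap, hd, Int.mem_zmultiples_iff, ← Int.natAbs_dvd,
    ← hindex]
  constructor
  · rintro ⟨k, hk⟩
    obtain ⟨y, rfl⟩ := hφ k
    obtain ⟨c, hc⟩ := (hker (x - (condOrder K O : ℕ) * y)).1 (by
      rw [map_sub, hk, ← nsmul_eq_mul (condOrder K O) y, map_nsmul, nsmul_eq_mul, sub_self])
    exact ⟨c, y, by rw [← hc]; ring⟩
  · rintro ⟨c, y, rfl⟩
    refine ⟨φ y, ?_⟩
    rw [map_add, (hker c).2 ⟨c, rfl⟩, ← nsmul_eq_mul, map_nsmul, nsmul_eq_mul, zero_add]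

theorem IsImagQuadOrder.isFractionRing {K : Type} [Field K] [NumberField K]
    {O : Subalgebra ℤ K} (hO : IsImagQuadOrder K O) : IsFractionRing O K := by
  have key (x : K) : ∃ n : ℤ, n ≠ 0 ∧ (n : K) * x ∈ O := by
    have hx : x ∈ Submodule.span ℚ (O : Set K) := hO.spans ▸ Submodule.mem_top
    induction hx using Submodule.span_induction with
    | mem x hx => exact ⟨1, one_ne_zero, by simpa using hx⟩
    | zero => exact ⟨1, one_ne_zero, by simp⟩
    | add x y _ _ hx hy =>
      obtain ⟨n, hn, h⟩ := hx
      obtain ⟨n', hn', h'⟩ := hy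
      refine ⟨n * n', mul_ne_zero hn hn', ?_⟩
      have : ((n * n' : ℤ) : K) * (x + y) = (n' : K) * (n * x) + (n : K) * (n' * y) := by
        push_cast; ring
      rw [this]
      exact add_mem (mul_mem (intCast_mem O n') h) (mul_mem (intCast_mem O n) h')
    | smul c x _ hx =>
      obtain ⟨n, hn, h⟩ := hx
      refine ⟨c.den * n, mul_ne_zero (by simp) hn, ?_⟩
      have : ((c.den * n : ℤ) : K) * (c • x) = (c.num : K) * (n * x) := by
        have hc : (c.den : K) * (c : K) = c.num := by
          exact_mod_cast congrArg (Rat.cast (K := K)) (Rat.den_mul_eq_num c)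
        rw [Rat.smul_def]
        push_cast
        linear_combination (n * x : K) * hc
      rw [this]
      exact mul_mem (intCast_mem O c.num) h
  refine IsFractionRing.of_field O K fun x ↦ ?_
  obtain ⟨n, hn, h⟩ := key x
  have hnK : (n : K) ≠ 0 := by exact_mod_cast hn
  refine ⟨⟨n * x, h⟩, (n : O), ?_⟩
  change x = (n * x) / ((n : O) : K)
  rw [SubringClass.coe_intCast]
  field_simp

end QuadraticOrders

section Extension

variable {K : Type} [Field K] [NumberField K] {O : Subalgebra ℤ K}

theorem isDedekindDomain_integralClosure : IsDedekindDomain (integralClosure ℤ K) :=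
  inferInstanceAs (IsDedekindDomain (NumberField.RingOfIntegers K))

theorem isFractionRing_integralClosure : IsFractionRing (integralClosure ℤ K) K :=
  inferInstanceAs (IsFractionRing (NumberField.RingOfIntegers K) K)

attribute [local instance] isDedekindDomain_integralClosure isFractionRing_integralClosure

/-- The inclusion of an order in the maximal order. -/
def IsImagQuadOrder.incl (hO : IsImagQuadOrder K O) : O →+* integralClosure ℤ K :=
  (Subalgebra.inclusion hO.le_integralClosure).toRingHom

theorem IsImagQuadOrder.incl_injective (hO : IsImagQuadOrder K O) :
    Function.Injective hO.incl :=
  Subalgebra.inclusion_injective hO.le_integralClosure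

theorem IsImagQuadOrder.incl_isIntegral (hO : IsImagQuadOrder K O) : hO.incl.IsIntegral := by
  intro x
  have hx : IsIntegral ℤ x :=
    (isIntegral_algebraMap_iff (A := integralClosure ℤ K) (B := K) Subtype.val_injective).1 x.2
  obtain ⟨p, hp, h⟩ := hx
  refine ⟨p.map (algebraMap ℤ O), hp.map _, ?_⟩
  rw [Polynomial.eval₂_map, ← h]
  congr 1

theorem IsImagQuadOrder.exists_incl_eq_mul (hO : IsImagQuadOrder K O) (N : ℕ)
    (z : integralClosure ℤ K) :
    ∃ s, hO.incl s = ((condOrder K O * N : ℕ) : integralClosure ℤ K) * z := by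
  have : ((((condOrder K O * N : ℕ) : integralClosure ℤ K) * z : integralClosure ℤ K) : K) ∈ O :=
    (hO.coe_mem_iff _).2 ⟨0, N * z, by push_cast; ring⟩
  exact ⟨⟨_, this⟩, Subtype.ext rfl⟩

theorem IsImagQuadOrder.extIdeal_eq_map (hO : IsImagQuadOrder K O) (a : Ideal O) :
    extIdeal K O a = a.map hO.incl := by
  unfold extIdeal Ideal.map
  congr 1
  ext x
  constructor
  · rintro ⟨y, hy, hyx⟩
    exact ⟨y, hy, Subtype.ext hyx⟩
  · rintro ⟨y, hy, rfl⟩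
    exact ⟨y, hy, rfl⟩

/-- Extension of invertible fractional ideals from an order to the maximal order. -/
def IsImagQuadOrder.extUnits (hO : IsImagQuadOrder K O) :
    (Frac K O)ˣ →* (Frac K (integralClosure ℤ K))ˣ :=
  haveI := hO.isFractionRing
  Units.map (FractionalIdeal.extendedHom' (f := hO.incl) (K := K) K
    (nonZeroDivisors_le_comap_nonZeroDivisors_of_injective _ hO.incl_injective)).toMonoidHom

theorem IsImagQuadOrder.coe_extUnits (hO : IsImagQuadOrder K O) {u : (Frac K O)ˣ} {a : Ideal O}
    (hu : (u : Frac K O) = a) :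
    (hO.extUnits u : Frac K (integralClosure ℤ K)) = (a.map hO.incl : Ideal _) := by
  have := hO.isFractionRing
  change FractionalIdeal.extended K _ (u : Frac K O) = _
  rw [hu]
  exact FractionalIdeal.extended_coeIdeal_eq_map _ _ _

theorem IsImagQuadOrder.isUnit_coeIdeal_of_mul_eq (hO : IsImagQuadOrder K O) {a b : Ideal O} {x : O}
    (hx : x ≠ 0) (h : a * b = Ideal.span {x}) : IsUnit (a : Frac K O) := by
  have := hO.isFractionRing
  refine isUnit_of_mul_isUnit_left (y := (b : Frac K O)) ?_
  rw [← FractionalIdeal.coeIdeal_mul, h, FractionalIdeal.coeIdeal_span_singleton]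
  refine IsUnit.of_mul_eq_one (FractionalIdeal.spanSingleton _ (algebraMap O K x)⁻¹) ?_
  rw [FractionalIdeal.spanSingleton_mul_spanSingleton, mul_inv_cancel₀,
    FractionalIdeal.spanSingleton_one]
  exact (map_ne_zero_iff _ (IsFractionRing.injective O K)).2 hx

theorem IsImagQuadOrder.primeTo_map_iff (hO : IsImagQuadOrder K O) (m : ℕ) (a : Ideal O) :
    primeTo K (integralClosure ℤ K) m (a.map hO.incl) ↔ primeTo K O m a :=
  sup_span_natCast_map_eq_top_iff hO.incl_injective hO.incl_isIntegral a

theorem IsImagQuadOrder.map_mem_Mset (hO : IsImagQuadOrder K O) {m : ℕ} {a : Ideal O}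
    (ha : a ∈ Mset K O m) : a.map hO.incl ∈ Mset K (integralClosure ℤ K) m := by
  obtain ⟨h0, hp, u, hu⟩ := ha
  refine ⟨?_, (hO.primeTo_map_iff m a).2 hp, ?_⟩
  · exact fun h ↦ h0 ((Ideal.map_eq_bot_iff_of_injective hO.incl_injective).1 h)
  · rw [← hO.coe_extUnits hu]
    exact (hO.extUnits u).isUnit

theorem IsImagQuadOrder.comap_mem_Mset (hO : IsImagQuadOrder K O) {N : ℕ}
    {b : Ideal (integralClosure ℤ K)} (hb : b ∈ Mset K (integralClosure ℤ K) (condOrder K O * N)) :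
    b.comap hO.incl ∈ Mset K O (condOrder K O * N) ∧ (b.comap hO.incl).map hO.incl = b := by
  obtain ⟨h0, hp, -⟩ := hb
  have hmap := map_comap_eq_of_sup_span_natCast_eq_top (hO.exists_incl_eq_mul N) hp
  obtain ⟨a, x, hx, hax⟩ := exists_comap_mul_eq_span_singleton hO.incl_injective
    hO.incl_isIntegral (hO.exists_incl_eq_mul N) h0 hp
  refine ⟨⟨fun h ↦ h0 ?_, ?_, hO.isUnit_coeIdeal_of_mul_eq hx hax⟩, hmap⟩
  · rw [← hmap, h]
    exact Ideal.map_bot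
  · rwa [← hO.primeTo_map_iff, hmap]

theorem IsImagQuadOrder.map_extUnits_Igrp (hO : IsImagQuadOrder K O) (N : ℕ) :
    (Igrp K O (condOrder K O * N)).map hO.extUnits =
      Igrp K (integralClosure ℤ K) (condOrder K O * N) := by
  rw [Igrp, Igrp, MonoidHom.map_closure]
  congr 1
  ext w
  constructor
  · rintro ⟨u, ⟨a, ha, hu⟩, rfl⟩
    exact ⟨_, hO.map_mem_Mset ha, hO.coe_extUnits hu⟩
  · rintro ⟨b, hb, hw⟩
    obtain ⟨ha, hmap⟩ := hO.comap_mem_Mset hb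
    obtain ⟨u, hu⟩ := ha.2.2
    refine ⟨u, ⟨_, ha, hu⟩, Units.ext ?_⟩
    rw [hO.coe_extUnits hu, hmap, hw]

theorem one_mem_Mset (K : Type) [Field K] [NumberField K] (O : Subalgebra ℤ K) (m : ℕ) :
    (1 : Ideal O) ∈ Mset K O m :=
  ⟨one_ne_zero, by simp [primeTo], by simp⟩

theorem IsImagQuadOrder.mul_mem_Mset (hO : IsImagQuadOrder K O) {m : ℕ} {a b : Ideal O}
    (ha : a ∈ Mset K O m) (hb : b ∈ Mset K O m) : a * b ∈ Mset K O m := by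
  have := hO.isFractionRing
  refine ⟨mul_ne_zero ha.1 hb.1, ?_, ?_⟩
  · exact Ideal.isCoprime_iff_sup_eq.1
      ((Ideal.isCoprime_iff_sup_eq.2 ha.2.1).mul_left (Ideal.isCoprime_iff_sup_eq.2 hb.2.1))
  · rw [FractionalIdeal.coeIdeal_mul]
    exact ha.2.2.mul hb.2.2

theorem IsImagQuadOrder.exists_mul_eq_of_mem_Igrp (hO : IsImagQuadOrder K O) {m : ℕ}
    {u : (Frac K O)ˣ} (hu : u ∈ Igrp K O m) :
    ∃ a ∈ Mset K O m, ∃ b ∈ Mset K O m, (u : Frac K O) * b = a := by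
  have := hO.isFractionRing
  induction hu using Subgroup.closure_induction with
  | mem u hu =>
    obtain ⟨a, ha, hu⟩ := hu
    exact ⟨a, ha, 1, one_mem_Mset K O m, by simp [hu]⟩
  | one => exact ⟨1, one_mem_Mset K O m, 1, one_mem_Mset K O m, by simp⟩
  | mul u v _ _ hu hv =>
    obtain ⟨a, ha, b, hb, h⟩ := hu
    obtain ⟨a', ha', b', hb', h'⟩ := hv
    refine ⟨a * a', hO.mul_mem_Mset ha ha', b * b', hO.mul_mem_Mset hb hb', ?_⟩
    rw [FractionalIdeal.coeIdeal_mul, FractionalIdeal.coeIdeal_mul, ← h, ← h', Units.val_mul]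
    ring
  | inv u _ hu =>
    obtain ⟨a, ha, b, hb, h⟩ := hu
    exact ⟨b, hb, a, ha, by rw [← h, Units.inv_mul_cancel_left]⟩

theorem IsImagQuadOrder.subgroupMap_extUnits_injective (hO : IsImagQuadOrder K O) (N : ℕ) :
    Function.Injective (hO.extUnits.subgroupMap (Igrp K O (condOrder K O * N))) := by
  have := hO.isFractionRing
  rw [injective_iff_map_eq_one]
  rintro ⟨u, hu⟩ h
  have h1 : hO.extUnits u = 1 := congrArg Subtype.val h
  obtain ⟨a, ha, b, hb, hab⟩ := hO.exists_mul_eq_of_mem_Igrp hu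
  obtain ⟨v, hv⟩ := hb.2.2
  have hmap : a.map hO.incl = b.map hO.incl := by
    have h2 := hO.coe_extUnits (u := u * v) (a := a) (by rw [Units.val_mul, hv, hab])
    rw [map_mul, h1, one_mul, hO.coe_extUnits hv] at h2
    exact (FractionalIdeal.coeIdeal_injective (K := K) h2).symm
  have heq : a = b := by
    rw [← comap_map_eq_of_sup_span_natCast_eq_top hO.incl_injective
      (hO.exists_incl_eq_mul N) ha.2.1, hmap, comap_map_eq_of_sup_span_natCast_eq_top
      hO.incl_injective (hO.exists_incl_eq_mul N) hb.2.1]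
  refine Subtype.ext ((mul_eq_right (b := v)).1 (Units.ext ?_))
  rw [Units.val_mul, hv, hab, heq]

theorem PgrpM_le_Igrp (K : Type) [Field K] [NumberField K] (O : Subalgebra ℤ K) (N m : ℕ) :
    PgrpM K O N m ≤ Igrp K O m := by
  refine Subgroup.closure_mono ?_
  rintro u ⟨ν, h0, hp, -, hu⟩
  exact ⟨_, ⟨by simpa using h0, hp, hu ▸ u.isUnit⟩, hu⟩

theorem IsImagQuadOrder.map_extUnits_PgrpM (hO : IsImagQuadOrder K O) (N : ℕ) :
    (PgrpM K O N (condOrder K O * N)).map hO.extUnits = PZgrp K N (condOrder K O * N) := by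
  have hspan (ν : O) : (Ideal.span {ν}).map hO.incl = Ideal.span {hO.incl ν} := by
    rw [Ideal.map_span, Set.image_singleton]
  rw [PgrpM, PZgrp, MonoidHom.map_closure]
  congr 1
  ext w
  constructor
  · rintro ⟨u, ⟨ν, h0, hp, ⟨μ, hμ⟩, hu⟩, rfl⟩
    obtain ⟨c, y, hy⟩ := (hO.coe_mem_iff (hO.incl μ)).1 μ.2
    refine ⟨hO.incl ν, (map_ne_zero_iff _ hO.incl_injective).2 h0, ?_,
      ⟨1 + N * c, c, rfl, y, ?_⟩, ?_⟩
    · rwa [← hspan, hO.primeTo_map_iff]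
    · rw [hμ, map_add, map_mul, map_one, map_natCast, hy]
      push_cast
      ring
    · rw [← hspan, hO.coe_extUnits hu]
  · rintro ⟨ν, h0, hp, ⟨a, c, ha, μ, hμ⟩, hw⟩
    obtain ⟨s, hs⟩ : ∃ s : O, hO.incl s = c + (condOrder K O : ℕ) * μ :=
      ⟨⟨_, (hO.coe_mem_iff _).2 ⟨c, μ, rfl⟩⟩, rfl⟩
    have hν : hO.incl (1 + N * s) = ν := by
      rw [map_add, map_mul, map_one, map_natCast, hs, hμ, ha]
      push_cast
      ring
    have hs0 : (1 + N * s : O) ≠ 0 := fun h ↦ h0 (by rw [← hν, h, map_zero])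
    obtain ⟨u, hu⟩ := hO.isUnit_coeIdeal_of_mul_eq hs0 (mul_one (Ideal.span {1 + N * s}))
    refine ⟨u, ⟨1 + N * s, hs0, ?_, ⟨s, rfl⟩, hu⟩, Units.ext ?_⟩
    · rwa [← hO.primeTo_map_iff, hspan, hν]
    · rw [hO.coe_extUnits hu, hspan, hν, hw]

/-- Extension of ideals as an isomorphism `I(O, ℓ_O N) ≃* I(O_K, ℓ_O N)`. -/
def IsImagQuadOrder.extEquiv (hO : IsImagQuadOrder K O) (N : ℕ) :
    Igrp K O (condOrder K O * N) ≃* Igrp K (integralClosure ℤ K) (condOrder K O * N) :=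
  (MulEquiv.ofBijective (hO.extUnits.subgroupMap (Igrp K O (condOrder K O * N)))
    ⟨hO.subgroupMap_extUnits_injective N, hO.extUnits.subgroupMap_surjective _⟩).trans
    (MulEquiv.subgroupCongr (hO.map_extUnits_Igrp N))

theorem IsImagQuadOrder.coe_extEquiv (hO : IsImagQuadOrder K O) (N : ℕ)
    (u : Igrp K O (condOrder K O * N)) : (hO.extEquiv N u : (Frac K _)ˣ) = hO.extUnits u := rfl

theorem IsImagQuadOrder.map_extEquiv (hO : IsImagQuadOrder K O) (N : ℕ) :
    ((PgrpM K O N (condOrder K O * N)).subgroupOf (Igrp K O (condOrder K O * N))).map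
        (hO.extEquiv N : _ →* _) =
      (PZgrp K N (condOrder K O * N)).subgroupOf
        (Igrp K (integralClosure ℤ K) (condOrder K O * N)) := by
  ext w
  rw [Subgroup.mem_subgroupOf, ← hO.map_extUnits_PgrpM]
  constructor
  · rintro ⟨u, hu, rfl⟩
    exact ⟨u, hu, rfl⟩
  · rintro ⟨u, hu, h⟩
    exact ⟨⟨u, PgrpM_le_Igrp K O _ _ hu⟩, hu, Subtype.ext h⟩

end Extension

/-!
STATEMENT 3: the assignment `[𝔞𝔟⁻¹] ↦ [(𝔞O_K)(𝔟O_K)⁻¹]`, for `𝔞, 𝔟` nonzero proper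
`O`-ideals prime to `ℓ_O N`, is a well-defined group isomorphism from
`C_N(O, ℓ_O N) = I(O, ℓ_O N)/P_N(O, ℓ_O N)` onto `I(O_K, ℓ_O N)/P_{ℤ,N}(O_K, ℓ_O N)`.
-/

theorem statement3 (K : Type) [Field K] [NumberField K]
    (O : Subalgebra ℤ K) (hO : IsImagQuadOrder K O) (N : ℕ) (hN : 0 < N) :
    ∃ e : ClsGrpM K O N (condOrder K O * N) ≃* GenClsGrp K N (condOrder K O * N),
      ∀ a b : Ideal O, a ∈ Mset K O (condOrder K O * N) → b ∈ Mset K O (condOrder K O * N) →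
        ∀ u v : (Frac K O)ˣ, (u : Frac K O) = a → (v : Frac K O) = b →
          ∀ hu : u * v⁻¹ ∈ Igrp K O (condOrder K O * N),
            ∀ w x : (Frac K (integralClosure ℤ K))ˣ,
              (w : Frac K (integralClosure ℤ K)) = extIdeal K O a →
              (x : Frac K (integralClosure ℤ K)) = extIdeal K O b →
                ∀ hw : w * x⁻¹ ∈ Igrp K (integralClosure ℤ K) (condOrder K O * N),
                  e (QuotientGroup.mk ⟨u * v⁻¹, hu⟩) = QuotientGroup.mk ⟨w * x⁻¹, hw⟩ := by
  refine ⟨QuotientGroup.congr _ _ (hO.extEquiv N) (hO.map_extEquiv N), ?_⟩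
  intro a b _ _ u v hu hv huv w x hw hx hwx
  rw [hO.extIdeal_eq_map] at hw hx
  rw [QuotientGroup.congr_mk]
  congr 1
  refine Subtype.ext ?_
  have hw' : hO.extUnits u = w := Units.ext ((hO.coe_extUnits hu).trans hw.symm)
  have hx' : hO.extUnits v = x := Units.ext ((hO.coe_extUnits hv).trans hx.symm)
  rw [hO.coe_extEquiv, map_mul, map_inv, hw', hx']
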